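/- Let L ≥ 3 and consider the third conserved charge of the spin-1/2 Heisenberg XXX chain on a periodic chain of 2L qubits, Q^{(3)} = Σ_{j=0}^{2L−1} S_j · (S_{j+1} × S_{j+2}) = Σ_{j=0}^{2L−1} Σ_{a,b,c} ε_{abc} S^a_j S^b_{j+1} S^c_{j+2}, indices mod 2L, where (S¹, S², S³) = (X, Y, Z) are the Pauli matrices acting on the indicated sites. Then for every 2×2 complex matrix A that is symmetric or antisymmetric, the crosscap state |Ψ_A⟩ satisfies Q^{(3)} |Ψ_A⟩ = 0. -/

import Mathlib

open Matrix BigOperators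

/-- The site `j + k` modulo the chain length `n`. -/
def shiftSite {n : ℕ} (j : Fin n) (k : ℕ) : Fin n :=
  ⟨(j.val + k) % n, Nat.mod_lt _ (Nat.lt_of_le_of_lt (Nat.zero_le _) j.isLt)⟩

/-- Site `j` (for `j < L`) viewed as a site of the chain of length `2*L`. -/
def lo {L : ℕ} (j : Fin L) : Fin (2 * L) := ⟨j.val, by have := j.isLt; omega⟩

/-- The antipodal site `j + L` of the chain of length `2*L`. -/
def hi {L : ℕ} (j : Fin L) : Fin (2 * L) := ⟨j.val + L, by have := j.isLt; omega⟩

/-- The crosscap state built from the `D × D` matrix `A` on a periodic chain of `2*L` sites: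
its coefficient on the computational basis state `f` is `∏_{j=0}^{L-1} A (f j) (f (j+L))`. -/
noncomputable def crosscap (L D : ℕ) (A : Matrix (Fin D) (Fin D) ℂ) :
    (Fin (2 * L) → Fin D) → ℂ :=
  fun f => ∏ j : Fin L, A (f (lo j)) (f (hi j))

/-- The translate `h(j)` of a local operator `h` of range `r`, acting on the sites
`j, j+1, …, j+r-1` (mod `n`) of a periodic chain of `n` sites, and as the identity elsewhere. -/
noncomputable def localOp {n D : ℕ} (r : ℕ)
    (h : Matrix (Fin r → Fin D) (Fin r → Fin D) ℂ) (j : Fin n) :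
    Matrix (Fin n → Fin D) (Fin n → Fin D) ℂ :=
  Matrix.of fun f g =>
    h (fun k => f (shiftSite j k.val)) (fun k => g (shiftSite j k.val)) *
      ∏ i : Fin n, if (∃ k : Fin r, i = shiftSite j k.val) ∨ f i = g i then 1 else 0

/-- The `r`-fold Kronecker power `A^{⊗r}` of a `D × D` matrix `A`. -/
noncomputable def kronPow {D : ℕ} (r : ℕ) (A : Matrix (Fin D) (Fin D) ℂ) :
    Matrix (Fin r → Fin D) (Fin r → Fin D) ℂ :=
  Matrix.of fun f g => ∏ k : Fin r, A (f k) (g k)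

/-- The one-site operator `M` acting at site `j`, identity elsewhere. -/
noncomputable def oneSite {n D : ℕ} (M : Matrix (Fin D) (Fin D) ℂ) (j : Fin n) :
    Matrix (Fin n → Fin D) (Fin n → Fin D) ℂ :=
  Matrix.of fun f g => M (f j) (g j) * ∏ i : Fin n, if i = j ∨ f i = g i then 1 else 0

/-- The Pauli matrix `X`. -/
noncomputable def PX : Matrix (Fin 2) (Fin 2) ℂ := !![0, 1; 1, 0]

/-- The Pauli matrix `Y`. -/
noncomputable def PY : Matrix (Fin 2) (Fin 2) ℂ := !![0, -Complex.I; Complex.I, 0]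

/-- The Pauli matrix `Z`. -/
noncomputable def PZ : Matrix (Fin 2) (Fin 2) ℂ := !![1, 0; 0, -1]

/-- The spin raising operator `σ⁺ = |1⟩⟨0|`. -/
noncomputable def sigmaPlus : Matrix (Fin 2) (Fin 2) ℂ := !![0, 0; 1, 0]

/-- The vector of Pauli matrices `(S¹, S², S³) = (X, Y, Z)`. -/
noncomputable def pauliVec : Fin 3 → Matrix (Fin 2) (Fin 2) ℂ := ![PX, PY, PZ]

/-- The Levi-Civita symbol on three indices. -/
def levicivita (a b c : Fin 3) : ℂ :=
  if (a, b, c) = (0, 1, 2) ∨ (a, b, c) = (1, 2, 0) ∨ (a, b, c) = (2, 0, 1) then 1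
  else if (a, b, c) = (0, 2, 1) ∨ (a, b, c) = (2, 1, 0) ∨ (a, b, c) = (1, 0, 2) then -1
  else 0

/-- The third conserved charge of the XXX Heisenberg chain on `2L` qubits:
`Q³ = Σ_j S_j · (S_{j+1} × S_{j+2}) = Σ_j Σ_{a,b,c} ε_{abc} S^a_j S^b_{j+1} S^c_{j+2}`. -/
noncomputable def Q3 (L : ℕ) : Matrix (Fin (2 * L) → Fin 2) (Fin (2 * L) → Fin 2) ℂ :=
  ∑ j : Fin (2 * L), ∑ a : Fin 3, ∑ b : Fin 3, ∑ c : Fin 3,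
    levicivita a b c •
      (oneSite (pauliVec a) j * oneSite (pauliVec b) (shiftSite j 1) *
        oneSite (pauliVec c) (shiftSite j 2))

lemma shiftSite_zero {n : ℕ} (j : Fin n) : shiftSite j 0 = j := by
  ext
  simp [shiftSite, Nat.mod_eq_of_lt j.isLt]

lemma shiftSite_shiftSite {n : ℕ} (j : Fin n) (a b : ℕ) :
    shiftSite (shiftSite j a) b = shiftSite j (a + b) := by
  ext
  simp [shiftSite, add_assoc]

lemma shiftSite_self_length {n : ℕ} (j : Fin n) : shiftSite j n = j := by
  ext
  simp [shiftSite, Nat.mod_eq_of_lt j.isLt]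

lemma shiftSite_inj {n : ℕ} (j : Fin n) {a b : ℕ} (ha : a < n) (hb : b < n) :
    shiftSite j a = shiftSite j b ↔ a = b := by
  refine ⟨fun h => ?_, fun h => h ▸ rfl⟩
  have h' : j.val + a ≡ j.val + b [MOD n] := congrArg Fin.val h
  exact Nat.ModEq.eq_of_lt_of_lt (Nat.ModEq.add_left_cancel' _ h') ha hb

/-- A one-site operator acts on a vector by summing over the spin values at its site. -/
lemma oneSite_mulVec {n D : ℕ} (M : Matrix (Fin D) (Fin D) ℂ) (j : Fin n)
    (v : (Fin n → Fin D) → ℂ) (f : Fin n → Fin D) :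
    (oneSite M j).mulVec v f = ∑ p, M (f j) p * v (Function.update f j p) := by
  classical
  have key : ∀ g : Fin n → Fin D,
      (∏ i : Fin n, if i = j ∨ f i = g i then (1 : ℂ) else 0) =
        if Function.update f j (g j) = g then 1 else 0 := by
    intro g
    have hiff : (∀ i ∈ Finset.univ, i = j ∨ f i = g i) ↔ Function.update f j (g j) = g := by
      simp only [Function.update_eq_iff, Finset.mem_univ, true_imp_iff, true_and, ne_eq]
      exact forall_congr' fun i => by tauto
    simp only [Finset.prod_ite_zero, Finset.prod_const_one, hiff]
  simp only [mulVec, dotProduct, oneSite, of_apply, key]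
  symm
  refine Finset.sum_of_injOn (Function.update f j) ?_ ?_ ?_ ?_
  · exact fun p _ q _ h => Function.update_injective f j h
  · simp
  · intro g _ hg
    rw [if_neg]
    · simp
    · exact fun h => hg ⟨g j, by simp, h⟩
  · intro p _
    simp

/-- The local density `S · (S × S)` is proportional to the difference of the two cyclic
permutations of its three sites. -/
lemma triple_product_apply {n : ℕ} (x y z : Fin n) (hxy : x ≠ y) (hxz : x ≠ z) (hyz : y ≠ z)
    (v : (Fin n → Fin 2) → ℂ) (f : Fin n → Fin 2) :
    (∑ a : Fin 3, ∑ b : Fin 3, ∑ c : Fin 3, levicivita a b c •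
      (oneSite (pauliVec a) x * oneSite (pauliVec b) y * oneSite (pauliVec c) z)).mulVec v f =
    2 * Complex.I *
      (v (Function.update (Function.update (Function.update f x (f y)) y (f z)) z (f x)) -
       v (Function.update (Function.update (Function.update f x (f z)) y (f x)) z (f y))) := by
  generalize hu : (fun p q r => v (Function.update (Function.update (Function.update f x p) y q) z r))
    = u
  have hu' : ∀ p q r,
      v (Function.update (Function.update (Function.update f x p) y q) z r) = u p q r :=
    fun p q r => by rw [← hu]
  simp only [Matrix.sum_mulVec, Finset.sum_apply, Matrix.smul_mulVec, Pi.smul_apply,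
    ← Matrix.mulVec_mulVec, oneSite_mulVec, hu', Function.update_of_ne hxy.symm,
    Function.update_of_ne hxz.symm, Function.update_of_ne hyz.symm]
  generalize f x = p
  generalize f y = q
  generalize f z = r
  fin_cases p <;> fin_cases q <;> fin_cases r <;>
    simp [Fin.sum_univ_three, levicivita, pauliVec, PX, PY, PZ] <;> ring

/-- Up to a sign, the crosscap state may be read off from any `L` consecutive sites. -/
lemma crosscap_window {L D : ℕ} (A : Matrix (Fin D) (Fin D) ℂ) (s : ℂ)
    (hA : ∀ p q, A q p = s * A p q) (g : Fin (2 * L) → Fin D) (j : Fin (2 * L)) :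
    s ^ j.val * crosscap L D A g =
      ∏ i ∈ Finset.range L, A (g (shiftSite j i)) (g (shiftSite j (i + L))) := by
  obtain ⟨k, hk⟩ := j
  induction k with
  | zero =>
    rw [← Fin.prod_univ_eq_prod_range
      (fun i => A (g (shiftSite ⟨0, hk⟩ i)) (g (shiftSite ⟨0, hk⟩ (i + L))))]
    simp only [pow_zero, one_mul, crosscap]
    refine Finset.prod_congr rfl fun i _ => ?_
    have hi' := i.isLt
    congr 2 <;> ext <;> simp [lo, hi, shiftSite] <;> rw [Nat.mod_eq_of_lt (by omega)]
  | succ k ih =>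
    obtain ⟨m, rfl⟩ : ∃ m, L = m + 1 := ⟨L - 1, by omega⟩
    have hk' : k < 2 * (m + 1) := by omega
    have step : ∀ i, shiftSite (⟨k + 1, hk⟩ : Fin (2 * (m + 1))) i = shiftSite ⟨k, hk'⟩ (i + 1) := by
      intro i
      ext
      simp only [shiftSite]
      congr 1
      omega
    have wrap : shiftSite (⟨k, hk'⟩ : Fin (2 * (m + 1))) (m + (m + 1) + 1) =
        shiftSite ⟨k, hk'⟩ 0 := by
      rw [show m + (m + 1) + 1 = 2 * (m + 1) by omega, shiftSite_self_length, shiftSite_zero]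
    rw [pow_succ', mul_assoc, ih hk', Finset.prod_range_succ', Finset.prod_range_succ]
    simp only [step]
    rw [wrap, hA (g (shiftSite ⟨k, hk'⟩ 0)), zero_add]
    simp only [add_right_comm]
    ring

/-- The two cyclic permutations of a window of three sites are exchanged, on the crosscap state,
with those of the antipodal window. -/
lemma crosscap_update_antipodal {L D : ℕ} (hL : 3 ≤ L) (A : Matrix (Fin D) (Fin D) ℂ) (s : ℂ)
    (hs : s ≠ 0) (hA : ∀ p q, A q p = s * A p q) (f : Fin (2 * L) → Fin D) (j : Fin (2 * L))
    {p q r p' q' r' : Fin D}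
    (h : A p (f (shiftSite j L)) * A q (f (shiftSite j (L + 1))) * A r (f (shiftSite j (L + 2))) =
      A (f (shiftSite j 0)) p' * A (f (shiftSite j 1)) q' * A (f (shiftSite j 2)) r') :
    crosscap L D A (Function.update (Function.update (Function.update f
        (shiftSite j 0) p) (shiftSite j 1) q) (shiftSite j 2) r) =
      crosscap L D A (Function.update (Function.update (Function.update f
        (shiftSite j L) p') (shiftSite j (L + 1)) q') (shiftSite j (L + 2)) r') := by
  refine mul_left_cancel₀ (pow_ne_zero j.val hs) ?_
  rw [crosscap_window A s hA, crosscap_window A s hA]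
  obtain ⟨m, rfl⟩ : ∃ m, L = m + 3 := ⟨L - 3, by omega⟩
  have upd : ∀ (a b c e : ℕ) (u v w : Fin D), a < 2 * (m + 3) → b < 2 * (m + 3) →
      c < 2 * (m + 3) → e < 2 * (m + 3) →
      Function.update (Function.update (Function.update f
        (shiftSite j a) u) (shiftSite j b) v) (shiftSite j c) w (shiftSite j e) =
      if e = c then w else if e = b then v else if e = a then u else f (shiftSite j e) := by
    intro a b c e u v w ha hb hc he
    simp only [Function.update_apply, shiftSite_inj j he ha, shiftSite_inj j he hb,
      shiftSite_inj j he hc]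
  simp only [Finset.prod_range_succ']
  rw [mul_assoc, mul_assoc, mul_assoc, mul_assoc]
  congr 1
  · refine Finset.prod_congr rfl fun i hi => ?_
    have := Finset.mem_range.mp hi
    repeat rw [upd _ _ _ _ _ _ _ (by omega) (by omega) (by omega) (by omega)]
    congr 1
    · repeat rw [if_neg (by omega)]
    · repeat rw [if_neg (by omega)]
  · repeat rw [upd _ _ _ _ _ _ _ (by omega) (by omega) (by omega) (by omega)]
    simp
    simp [add_comm, add_left_comm] at h ⊢
    linear_combination h

/-- for every 2×2 complex matrix `A` that is symmetric or antisymmetric, the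
crosscap state `|Ψ_A⟩` is annihilated by the third charge `Q³` of the XXX chain. -/
theorem q3_annihilates_crosscap (L : ℕ) (hL : 3 ≤ L)
    (A : Matrix (Fin 2) (Fin 2) ℂ) (hA : Aᵀ = A ∨ Aᵀ = -A) :
    (Q3 L).mulVec (crosscap L 2 A) = 0 := by
  obtain ⟨s, hs, hsA⟩ : ∃ s : ℂ, s ≠ 0 ∧ ∀ p q, A q p = s * A p q := by
    rcases hA with h | h
    · exact ⟨1, one_ne_zero, fun p q => by simpa using congrFun (congrFun h p) q⟩
    · exact ⟨-1, by simp, fun p q => by simpa using congrFun (congrFun h p) q⟩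
  funext f
  have hdens : ∀ j : Fin (2 * L), _ := fun j =>
    triple_product_apply (shiftSite j 0) (shiftSite j 1) (shiftSite j 2)
      (by rw [Ne, shiftSite_inj] <;> omega) (by rw [Ne, shiftSite_inj] <;> omega)
      (by rw [Ne, shiftSite_inj] <;> omega) (crosscap L 2 A) f
  rw [Q3, Matrix.sum_mulVec, Finset.sum_apply, Pi.zero_apply]
  have hinv : ∀ j : Fin (2 * L), shiftSite (shiftSite j L) L = j := fun j => by
    rw [shiftSite_shiftSite, ← two_mul, shiftSite_self_length]
  refine Finset.sum_involution (fun j _ => shiftSite j L) (fun j _ => ?_) (fun j _ _ h => ?_)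
    (fun j _ => Finset.mem_univ _) (fun j _ => hinv j)
  · have h₁ := hdens j
    have h₂ := hdens (shiftSite j L)
    have e₁ := crosscap_update_antipodal hL A s hs hsA f j
      (p := f (shiftSite j 2)) (q := f (shiftSite j 0)) (r := f (shiftSite j 1))
      (p' := f (shiftSite j (L + 1))) (q' := f (shiftSite j (L + 2))) (r' := f (shiftSite j L))
      (by ring)
    have e₂ := crosscap_update_antipodal hL A s hs hsA f j
      (p := f (shiftSite j 1)) (q := f (shiftSite j 2)) (r := f (shiftSite j 0))
      (p' := f (shiftSite j (L + 2))) (q' := f (shiftSite j L)) (r' := f (shiftSite j (L + 1)))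
      (by ring)
    rw [e₁, e₂, shiftSite_zero] at h₁
    simp only [shiftSite_zero (shiftSite j L)] at h₂
    rw [h₁, h₂]
    simp only [shiftSite_shiftSite]
    ring
  · have h0 : shiftSite j L = shiftSite j 0 := h.trans (shiftSite_zero j).symm
    rw [shiftSite_inj] at h0 <;> omega
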